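/- Let 0 < ε ≤ 1, 0 < p ≤ 1, let F = [[ε,0],[0,1]] (a 2×2 real filter matrix), F₃ = F⊗F⊗F, and let ρ(p) = p|W³⟩⟨W³| + (1−p)|e₀₀₀⟩⟨e₀₀₀| with W³ = (1/√3)(e₀₀₁ + e₀₁₀ + e₁₀₀) ∈ ℂ⁸. Then F₃ * ρ(p) * F₃† = p·ε⁴·|W³⟩⟨W³| + (1−p)·ε⁶·|e₀₀₀⟩⟨e₀₀₀|, its trace equals p·ε⁴ + (1−p)·ε⁶, and consequently the normalized filtered state F₃ρ(p)F₃† / Tr(F₃ρ(p)F₃†) equals (p ε⁴ |W³⟩⟨W³| + (1−p) ε⁶ |e₀₀₀⟩⟨e₀₀₀|) / (p ε⁴ + (1−p) ε⁶). -/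

import Mathlib

open Matrix Kronecker

/-- Standard basis vector `e_{abc}` of `ℂ⁸ = ℂ²⊗ℂ²⊗ℂ²`. -/
def e3 (i j k : Fin 2) : (Fin 2 × Fin 2) × Fin 2 → ℂ :=
  fun q => if q = ((i, j), k) then 1 else 0

/-- The three-qubit W state `W³ = (e₀₀₁ + e₀₁₀ + e₁₀₀)/√3`. -/
noncomputable def W3 : (Fin 2 × Fin 2) × Fin 2 → ℂ :=
  (Real.sqrt 3 : ℂ)⁻¹ • (e3 0 0 1 + e3 0 1 0 + e3 1 0 0)

/-- `ρ(p) = p|W³⟩⟨W³| + (1−p)|000⟩⟨000|`. -/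
noncomputable def rhoP (p : ℝ) :
    Matrix ((Fin 2 × Fin 2) × Fin 2) ((Fin 2 × Fin 2) × Fin 2) ℂ :=
  (p : ℂ) • vecMulVec W3 (star W3)
    + ((1 - p : ℝ) : ℂ) • vecMulVec (e3 0 0 0) (star (e3 0 0 0))

/-- The local filter `F = diag(ε, 1)`. -/
noncomputable def filt (ε : ℝ) : Matrix (Fin 2) (Fin 2) ℂ := !![(ε : ℂ), 0; 0, 1]

/-- The three-qubit filter `F₃ = F⊗F⊗F`. -/
noncomputable def filt3 (ε : ℝ) :
    Matrix ((Fin 2 × Fin 2) × Fin 2) ((Fin 2 × Fin 2) × Fin 2) ℂ :=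
  (filt ε ⊗ₖ filt ε) ⊗ₖ filt ε

lemma Matrix.mul_vecMulVec_star_mul_conjTranspose {m n R : Type*} [Fintype n]
    [CommSemiring R] [StarRing R] (A : Matrix m n R) (v : n → R) :
    A * vecMulVec v (star v) * Aᴴ = vecMulVec (A *ᵥ v) (star (A *ᵥ v)) := by
  rw [mul_vecMulVec, vecMulVec_mul, star_mulVec]

lemma Matrix.vecMulVec_smul_star_smul {n R : Type*} [CommSemiring R] [StarRing R]
    (c : R) (v : n → R) :
    vecMulVec (c • v) (star (c • v)) = (c * star c) • vecMulVec v (star v) := by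
  ext i j
  simp only [vecMulVec_apply, Pi.smul_apply, Pi.star_apply, smul_apply, smul_eq_mul, star_mul']
  ring

lemma filt3_eq_diagonal (ε : ℝ) :
    filt3 ε = diagonal fun q : (Fin 2 × Fin 2) × Fin 2 =>
      (![(ε : ℂ), 1] q.1.1 * ![(ε : ℂ), 1] q.1.2) * ![(ε : ℂ), 1] q.2 := by
  have h : filt ε = diagonal ![(ε : ℂ), 1] := by
    ext i j
    fin_cases i <;> fin_cases j <;> simp [filt]
  rw [filt3, h, diagonal_kronecker_diagonal, diagonal_kronecker_diagonal]

lemma filt3_mulVec_e3 (ε : ℝ) (i j k : Fin 2) :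
    filt3 ε *ᵥ e3 i j k =
      (![(ε : ℂ), 1] i * ![(ε : ℂ), 1] j * ![(ε : ℂ), 1] k) • e3 i j k := by
  ext q
  rw [filt3_eq_diagonal, mulVec_diagonal, Pi.smul_apply, smul_eq_mul, e3]
  split_ifs with h
  · rw [h]
  · simp

lemma filt3_mulVec_W3 (ε : ℝ) : filt3 ε *ᵥ W3 = ((ε : ℂ) ^ 2) • W3 := by
  simp only [W3, mulVec_smul, mulVec_add, filt3_mulVec_e3]
  simp only [cons_val_zero, cons_val_one, mul_one, one_mul]
  module

lemma trace_vecMulVec_e3 (i j k : Fin 2) :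
    (vecMulVec (e3 i j k) (star (e3 i j k))).trace = 1 := by
  simp [trace_vecMulVec, dotProduct, e3]

lemma trace_vecMulVec_W3 : (vecMulVec W3 (star W3)).trace = 1 := by
  have h : ((Real.sqrt 3 : ℝ) : ℂ) ^ 2 = 3 := by
    rw [← Complex.ofReal_pow, Real.sq_sqrt (by norm_num)]
    norm_num
  simp [trace_vecMulVec, dotProduct, W3, e3, Fintype.sum_prod_type]
  field_simp
  rw [h]
  norm_num

lemma filt3_mul_rhoP_mul_conjTranspose (ε p : ℝ) :
    filt3 ε * rhoP p * (filt3 ε)ᴴ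
      = ((p * ε ^ 4 : ℝ) : ℂ) • vecMulVec W3 (star W3)
        + (((1 - p) * ε ^ 6 : ℝ) : ℂ) • vecMulVec (e3 0 0 0) (star (e3 0 0 0)) := by
  rw [rhoP, Matrix.mul_add, Matrix.add_mul, Matrix.mul_smul, Matrix.mul_smul, Matrix.smul_mul,
    Matrix.smul_mul, mul_vecMulVec_star_mul_conjTranspose, mul_vecMulVec_star_mul_conjTranspose,
    filt3_mulVec_W3, filt3_mulVec_e3, vecMulVec_smul_star_smul, vecMulVec_smul_star_smul,
    smul_smul, smul_smul]
  congr 2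
  · simp only [RCLike.star_def, map_pow, Complex.conj_ofReal]
    push_cast
    ring
  · simp only [cons_val_zero, RCLike.star_def, map_mul, Complex.conj_ofReal]
    push_cast
    ring

/-- Eq. (13) of the paper: applying the local filter `diag(ε,1)` to each
qubit of `ρ(p)` gives `F₃ ρ(p) F₃† = p ε⁴|W³⟩⟨W³| + (1−p) ε⁶|000⟩⟨000|`, whose trace
is `p ε⁴ + (1−p) ε⁶`, and the normalized filtered state is the corresponding ratio. -/
theorem persistency_stmt9 (ε p : ℝ) (hε0 : 0 < ε) (hε1 : ε ≤ 1) (hp0 : 0 < p) (hp1 : p ≤ 1) :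
    filt3 ε * rhoP p * (filt3 ε)ᴴ
        = ((p * ε ^ 4 : ℝ) : ℂ) • vecMulVec W3 (star W3)
          + (((1 - p) * ε ^ 6 : ℝ) : ℂ) • vecMulVec (e3 0 0 0) (star (e3 0 0 0)) ∧
    (filt3 ε * rhoP p * (filt3 ε)ᴴ).trace = ((p * ε ^ 4 + (1 - p) * ε ^ 6 : ℝ) : ℂ) ∧
    ((filt3 ε * rhoP p * (filt3 ε)ᴴ).trace)⁻¹ • (filt3 ε * rhoP p * (filt3 ε)ᴴ)
        = (((p * ε ^ 4 + (1 - p) * ε ^ 6 : ℝ) : ℂ))⁻¹ •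
            (((p * ε ^ 4 : ℝ) : ℂ) • vecMulVec W3 (star W3)
              + (((1 - p) * ε ^ 6 : ℝ) : ℂ) •
                  vecMulVec (e3 0 0 0) (star (e3 0 0 0))) := by
  have h := filt3_mul_rhoP_mul_conjTranspose ε p
  have htr : (filt3 ε * rhoP p * (filt3 ε)ᴴ).trace
      = ((p * ε ^ 4 + (1 - p) * ε ^ 6 : ℝ) : ℂ) := by
    rw [h, trace_add, trace_smul, trace_smul, trace_vecMulVec_W3, trace_vecMulVec_e3]
    simp
  exact ⟨h, htr, by rw [htr, h]⟩
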